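/- arXiv:2103.13101 — 2 statements merged into one kernel-verified Lean document; each statement's English description precedes it below -/
import Mathlib

section
/- Let α ∈ (0, 1/2). For a probability measure μ on ℝ with finite first moment, write m(μ) = ∫ z dμ(z), and define b(x, μ) = −2(x + α m(μ)) and σ(x, μ) = x + α m(μ). Then for all probability measures μ, ν on ℝ with finite second moments and every coupling π of μ and ν, ∫_{ℝ×ℝ} ( 2 (b(x,μ) − b(y,ν)) (x − y) + (σ(x,μ) − σ(y,ν))² ) dπ(x,y) ≤ −(2 − 2α) ∫_{ℝ×ℝ} (x − y)² dπ(x,y). -/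
open MeasureTheory

/-- Example 2 (Landau-type DDSDE): the coefficients `b(x,μ) = -2(x + α m(μ))`
and `σ(x,μ) = x + α m(μ)`, with `m(μ) = ∫ z dμ(z)` and `α ∈ (0, 1/2)`, satisfy
the integrated strong monotonicity condition (H) with constant `2 - 2α`. -/
theorem stmt_2
    (α : ℝ) (hα₀ : 0 < α) (hα : α < 1 / 2)
    (m : Measure ℝ → ℝ) (hm : ∀ μ : Measure ℝ, m μ = ∫ z, z ∂μ)
    (b σ : ℝ → Measure ℝ → ℝ)
    (hb : ∀ x μ, b x μ = -2 * (x + α * m μ))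
    (hσ : ∀ x μ, σ x μ = x + α * m μ) :
    ∀ μ ν : Measure ℝ,
      IsProbabilityMeasure μ → IsProbabilityMeasure ν →
      Integrable (fun x => x ^ 2) μ → Integrable (fun x => x ^ 2) ν →
      ∀ π : Measure (ℝ × ℝ), IsProbabilityMeasure π →
        π.map Prod.fst = μ → π.map Prod.snd = ν →
        ∫ p, (2 * (b p.1 μ - b p.2 ν) * (p.1 - p.2) +
            (σ p.1 μ - σ p.2 ν) ^ 2) ∂π ≤
          -(2 - 2 * α) * ∫ p, (p.1 - p.2) ^ 2 ∂π := by
  intro μ ν _ _ h1 h2 π _ hp1 hp2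
  have a1 : MemLp (fun p : ℝ × ℝ => p.1) 2 π := by
    rw [memLp_two_iff_integrable_sq measurable_fst.aestronglyMeasurable]
    rw [← hp1] at h1
    exact h1.comp_measurable measurable_fst
  have a2 : MemLp (fun p : ℝ × ℝ => p.2) 2 π := by
    rw [memLp_two_iff_integrable_sq measurable_snd.aestronglyMeasurable]
    rw [← hp2] at h2
    exact h2.comp_measurable measurable_snd
  have i1 : Integrable (fun p : ℝ × ℝ => p.1) π := a1.integrable (by norm_num)
  have i2 : Integrable (fun p : ℝ × ℝ => p.2) π := a2.integrable (by norm_num)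
  have iD : Integrable (fun p : ℝ × ℝ => p.1 - p.2) π := i1.sub i2
  have iD2 : Integrable (fun p : ℝ × ℝ => (p.1 - p.2) ^ 2) π := (a1.sub a2).integrable_sq
  have m1 : m μ = ∫ p, p.1 ∂π := by
    rw [hm, ← hp1]
    exact integral_map measurable_fst.aemeasurable measurable_id.aestronglyMeasurable
  have m2 : m ν = ∫ p, p.2 ∂π := by
    rw [hm, ← hp2]
    exact integral_map measurable_snd.aemeasurable measurable_id.aestronglyMeasurable
  have hd : ∫ p, (p.1 - p.2) ∂π = m μ - m ν := by
    rw [m1, m2]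
    exact integral_sub i1 i2
  obtain ⟨d, hdd⟩ : ∃ d, d = m μ - m ν := ⟨_, rfl⟩
  have key : ∫ p, (2 * (b p.1 μ - b p.2 ν) * (p.1 - p.2) +
      (σ p.1 μ - σ p.2 ν) ^ 2) ∂π
      = ∫ p, ((-3) * (p.1 - p.2) ^ 2 + (-2 * α * d) * (p.1 - p.2) + α ^ 2 * d ^ 2) ∂π := by
    congr 1
    funext p
    rw [hb, hb, hσ, hσ, hdd]
    ring
  have iS : Integrable (fun p : ℝ × ℝ =>
      (-3) * (p.1 - p.2) ^ 2 + (-2 * α * d) * (p.1 - p.2)) π :=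
    (iD2.const_mul _).add (iD.const_mul _)
  rw [key, integral_add iS (integrable_const _),
    integral_add (iD2.const_mul _) (iD.const_mul _), integral_const_mul, integral_const_mul, hd,
    ← hdd]
  have hE : 0 ≤ ∫ p, (p.1 - p.2) ^ 2 ∂π := integral_nonneg fun p => sq_nonneg _
  simp only [integral_const, probReal_univ, one_smul]
  nlinarith [mul_nonneg hα₀.le hE, mul_nonneg (mul_nonneg hα₀.le (by linarith : 0 ≤ 2 - α)) (sq_nonneg d)]
end

section
/- Let α ∈ (0, 1/2) and let μ be a probability measure on ℝ with finite fourth moment. Write a₁ = ∫ z dμ(z) and a₂ = ∫ z² dμ(z), and define for x ∈ ℝ: G(x) = −8 x (x + α a₁)(x² + α a₂) + (x + α a₁)² (6 x² + 2 α a₂) − 8 α (x² + α a₂)(a₂ + α a₁²) + 2 α (x² + α a₂) ∫_ℝ (z + α a₁)² dμ(z). Then ∫_ℝ G(x) dμ(x) ≤ −(2 − 4α) ∫_ℝ (x² + α a₂)² dμ(x). -/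
open MeasureTheory

/-- Lyapunov drift condition for Example 2: with `a₁ = ∫ z dμ`, `a₂ = ∫ z² dμ`
and `G = L^μ V(·, μ)` the generator of the Landau-type DDSDE applied to
`V(x,μ) = (∫ (x² + αy²) dμ(y))²`, one has
`∫ G dμ ≤ -(2 - 4α) ∫ (x² + α a₂)² dμ(x)` for `α ∈ (0, 1/2)` and every
probability measure `μ` on `ℝ` with finite fourth moment. -/
theorem stmt_8
    (α : ℝ) (hα₀ : 0 < α) (hα : α < 1 / 2)
    (μ : Measure ℝ) [IsProbabilityMeasure μ]
    (hμ : Integrable (fun x => x ^ 4) μ)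
    (a₁ a₂ : ℝ) (ha₁ : a₁ = ∫ z, z ∂μ) (ha₂ : a₂ = ∫ z, z ^ 2 ∂μ)
    (G : ℝ → ℝ)
    (hG : ∀ x : ℝ, G x =
      -8 * x * (x + α * a₁) * (x ^ 2 + α * a₂) +
      (x + α * a₁) ^ 2 * (6 * x ^ 2 + 2 * α * a₂) -
      8 * α * (x ^ 2 + α * a₂) * (a₂ + α * a₁ ^ 2) +
      2 * α * (x ^ 2 + α * a₂) * ∫ z, (z + α * a₁) ^ 2 ∂μ) :
    ∫ x, G x ∂μ ≤ -(2 - 4 * α) * ∫ x, (x ^ 2 + α * a₂) ^ 2 ∂μ := by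
  have i4 : Integrable (fun x : ℝ => x ^ 4) μ := hμ
  have i0 : Integrable (fun _ : ℝ => (1 : ℝ)) μ := integrable_const 1
  have key : ∀ f : ℝ → ℝ, Continuous f → (∀ x, |f x| ≤ 1 + x ^ 4) → Integrable f μ := by
    intro f hf hb
    refine (i0.add i4).mono' hf.aestronglyMeasurable (Filter.Eventually.of_forall fun x => ?_)
    simpa using hb x
  have i1 : Integrable (fun x : ℝ => x) μ := by
    refine key _ (by fun_prop) fun x => abs_le.2 ⟨?_, ?_⟩ <;>
      nlinarith [sq_nonneg (x ^ 2 - 1 / 2), sq_nonneg (x - 1 / 2), sq_nonneg (x + 1 / 2)]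
  have i2 : Integrable (fun x : ℝ => x ^ 2) μ := by
    refine key _ (by fun_prop) fun x => abs_le.2 ⟨?_, ?_⟩ <;>
      nlinarith [sq_nonneg (x ^ 2 - 1), sq_nonneg (x ^ 2), sq_nonneg x]
  have i3 : Integrable (fun x : ℝ => x ^ 3) μ := by
    refine key _ (by fun_prop) fun x => abs_le.2 ⟨?_, ?_⟩ <;>
      nlinarith [sq_nonneg (x ^ 2 - 1), sq_nonneg (x ^ 2 - x), sq_nonneg (x ^ 2 + x),
        sq_nonneg x]
  have P : ∀ c4 c3 c2 c1 c0 : ℝ,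
      ∫ x, (c4 * x ^ 4 + c3 * x ^ 3 + c2 * x ^ 2 + c1 * x + c0) ∂μ
        = c4 * (∫ x, x ^ 4 ∂μ) + c3 * (∫ x, x ^ 3 ∂μ) + c2 * a₂ + c1 * a₁ + c0 := by
    intro c4 c3 c2 c1 c0
    have j4 := i4.const_mul c4
    have j3 := i3.const_mul c3
    have j2 := i2.const_mul c2
    have j1 := i1.const_mul c1
    rw [integral_add (by fun_prop) (by fun_prop), integral_add (by fun_prop) (by fun_prop),
      integral_add (by fun_prop) (by fun_prop),
      integral_add j4 j3, integral_const_mul, integral_const_mul, integral_const_mul,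
      integral_const_mul, ha₁, ha₂]
    simp
  have P' : ∀ (f : ℝ → ℝ) (c4 c3 c2 c1 c0 : ℝ),
      (∀ x, f x = c4 * x ^ 4 + c3 * x ^ 3 + c2 * x ^ 2 + c1 * x + c0) →
      ∫ x, f x ∂μ
        = c4 * (∫ x, x ^ 4 ∂μ) + c3 * (∫ x, x ^ 3 ∂μ) + c2 * a₂ + c1 * a₁ + c0 := by
    intro f c4 c3 c2 c1 c0 h
    rw [← P]
    exact integral_congr_ae (Filter.Eventually.of_forall h)
  have hS := P' (fun z => (z + α * a₁) ^ 2) 0 0 1 (2 * α * a₁) (α ^ 2 * a₁ ^ 2)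
    (fun x => by ring)
  have hV := P' (fun x => (x ^ 2 + α * a₂) ^ 2) 1 0 (2 * α * a₂) 0 (α ^ 2 * a₂ ^ 2)
    (fun x => by ring)
  have hvar := P' (fun x => (x - a₁) ^ 2) 0 0 1 (-2 * a₁) (a₁ ^ 2) (fun x => by ring)
  have hmix := P' (fun x => (x ^ 2 - a₁ * x) ^ 2) 1 (-2 * a₁) (a₁ ^ 2) 0 0
    (fun x => by ring)
  have hvar0 : 0 ≤ ∫ x, (x - a₁) ^ 2 ∂μ := integral_nonneg fun x => sq_nonneg _
  have hmix0 : 0 ≤ ∫ x, (x ^ 2 - a₁ * x) ^ 2 ∂μ := integral_nonneg fun x => sq_nonneg _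
  have hq : 0 ≤ ∫ x, x ^ 4 ∂μ := integral_nonneg fun x => by positivity
  have hs : 0 ≤ a₂ := ha₂ ▸ integral_nonneg fun x => sq_nonneg _
  set S := ∫ z, (z + α * a₁) ^ 2 ∂μ with hSdef
  have hGI := P' G (-8 + 6) (-8 * α * a₁ + 12 * α * a₁)
    (-8 * α * a₂ + 2 * α * a₂ + 6 * α ^ 2 * a₁ ^ 2 - 8 * α * (a₂ + α * a₁ ^ 2) + 2 * α * S)
    (-8 * α ^ 2 * a₁ * a₂ + 4 * α ^ 2 * a₁ * a₂)
    (2 * α ^ 3 * a₁ ^ 2 * a₂ - 8 * α ^ 2 * a₂ * (a₂ + α * a₁ ^ 2) + 2 * α ^ 2 * a₂ * S)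
    (fun x => by rw [hG x]; ring)
  rw [hGI, hV, hS]
  rw [hvar] at hvar0
  rw [hmix] at hmix0
  generalize (∫ x, x ^ 4 ∂μ) = q at *
  generalize (∫ x, x ^ 3 ∂μ) = t at *
  have hm : 0 ≤ a₂ - a₁ ^ 2 := by linarith
  have e1 := mul_nonneg hα₀.le hmix0
  have e2 := mul_nonneg (mul_nonneg hα₀.le hs) hm
  have e3 := mul_nonneg hα₀.le hq
  have e4 : 0 ≤ (a₁ ^ 2 * a₂) * α ^ 2 * (1 - α ^ 2) :=
    mul_nonneg (by positivity) (by nlinarith)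
  have e5 : 0 ≤ α * a₂ ^ 2 := by positivity
  have e6 : 0 ≤ α ^ 2 * a₂ ^ 2 := by positivity
  have e7 : 0 ≤ α ^ 3 * a₂ ^ 2 := by positivity
  nlinarith [e1, e2, e3, e4, e5, e6, e7]
end
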